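/- arXiv:2509.24596 — 4 statements merged into one kernel-verified Lean document; each statement's English description precedes it below -/
import Mathlib

section
/- There exists a compact subset H ⊆ ℝ² such that the eventual equality relation E₀ on 2^ℕ is Borel reducible to the arc-connectedness equivalence relation ≈_H on H. (One may take H to be the Knaster continuum, whose composants coincide with its arc components.) -/
open Set Topology Function

namespace Knaster

/-- The point of the ternary Cantor set with address `α`. -/
noncomputable def cantorPoint (α : ℕ → Bool) : ℝ :=
  Real.ofDigits fun i => cond (α i) (2 : Fin 3) 0

theorem continuous_cantorPoint : Continuous cantorPoint :=
  Real.continuous_ofDigits.comp <| continuous_pi fun i =>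
    (continuous_of_discreteTopology (f := fun b : Bool => cond b (2 : Fin 3) 0)).comp
      (continuous_apply i)

theorem cantorPoint_injective : Injective cantorPoint := by
  intro α β h
  have := ofDigits_zero_two_sequence_unique (by grind) (by grind) h
  funext i
  have hi := congrFun this i
  revert hi
  cases α i <;> cases β i <;> simp

theorem cantorPoint_nonneg (α : ℕ → Bool) : 0 ≤ cantorPoint α := Real.ofDigits_nonneg _

theorem cantorPoint_le_one (α : ℕ → Bool) : cantorPoint α ≤ 1 := Real.ofDigits_le_one _

/-- The involution flipping all digits, which acts on the Cantor set as `x ↦ 1 - x`. -/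
def flip (α : ℕ → Bool) : ℕ → Bool := fun i => !(α i)

theorem continuous_flip : Continuous flip :=
  continuous_pi fun i => (continuous_of_discreteTopology (f := Bool.not)).comp (continuous_apply i)

theorem flip_involutive : Involutive flip := fun α => funext fun i => Bool.not_not (α i)

theorem cantorPoint_add_flip (α : ℕ → Bool) : cantorPoint α + cantorPoint (flip α) = 1 := by
  rw [← Real.ofDigits_const_last_eq_one' (b := 3) (by norm_num)]
  unfold cantorPoint Real.ofDigits
  rw [← Summable.tsum_add Real.summable_ofDigitsTerm Real.summable_ofDigitsTerm]
  congr 1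
  funext i
  simp only [Real.ofDigitsTerm, flip]
  cases α i <;> norm_num

theorem cantorPoint_of_first_one {α : ℕ → Bool} {n : ℕ} (h0 : ∀ i < n, α i = false)
    (h1 : α n = true) :
    cantorPoint α = ((3 : ℝ) ^ (n + 1))⁻¹ * (2 + cantorPoint fun i => α (i + (n + 1))) := by
  unfold cantorPoint
  rw [Real.ofDigits_eq_sum_add_ofDigits _ (n + 1), Finset.sum_range_succ, Finset.sum_eq_zero]
  · simp only [Real.ofDigitsTerm, h1]
    norm_num
    ring
  · intro i hi
    simp [Real.ofDigitsTerm, h0 i (Finset.mem_range.mp hi)]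

/-- Whether one of the first `n` digits of `α` is `1`. -/
def seen (α : ℕ → Bool) : ℕ → Bool
  | 0 => false
  | n + 1 => seen α n || α n

/-- The involution flipping all digits after the first digit `1`. -/
def flipAfter (α : ℕ → Bool) : ℕ → Bool := fun i => xor (α i) (seen α i)

theorem continuous_seen (n : ℕ) : Continuous fun α => seen α n := by
  induction n with
  | zero => exact continuous_const
  | succ n ih =>
    exact (continuous_of_discreteTopology (f := fun p : Bool × Bool => p.1 || p.2)).comp
      (ih.prodMk (continuous_apply n))

theorem continuous_flipAfter : Continuous flipAfter :=
  continuous_pi fun i =>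
    (continuous_of_discreteTopology (f := fun p : Bool × Bool => xor p.1 p.2)).comp
      ((continuous_apply i).prodMk (continuous_seen i))

theorem seen_flipAfter (α : ℕ → Bool) (n : ℕ) : seen (flipAfter α) n = seen α n := by
  induction n with
  | zero => rfl
  | succ n ih =>
    simp only [seen, ih, flipAfter]
    cases seen α n <;> simp

theorem flipAfter_involutive : Involutive flipAfter := fun α => by
  funext i
  change xor (xor (α i) (seen α i)) (seen (flipAfter α) i) = α i
  rw [seen_flipAfter]
  simp

theorem seen_eq_false {α : ℕ → Bool} {n : ℕ} (h : ∀ i < n, α i = false) : seen α n = false := by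
  induction n with
  | zero => rfl
  | succ n ih => simp [seen, ih fun i hi => h i (by omega), h n (by omega)]

theorem seen_eq_true {α : ℕ → Bool} {n m : ℕ} (h : α n = true) (hm : n < m) :
    seen α m = true := by
  induction m with
  | zero => omega
  | succ m ih =>
    rcases Nat.lt_succ_iff_lt_or_eq.mp hm with hlt | rfl
    · simp [seen, ih hlt]
    · simp [seen, h]

theorem flipAfter_apply_of_first_one {α : ℕ → Bool} {n : ℕ} (h0 : ∀ i < n, α i = false)
    (h1 : α n = true) :
    (∀ i < n, flipAfter α i = false) ∧ flipAfter α n = true ∧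
      ∀ i > n, flipAfter α i = !(α i) := by
  refine ⟨fun i hi => ?_, ?_, fun i hi => ?_⟩
  · simp [flipAfter, h0 i hi, seen_eq_false fun j hj => h0 j (hj.trans hi)]
  · simp [flipAfter, h1, seen_eq_false h0]
  · simp [flipAfter, seen_eq_true h1 hi]

theorem eq_zero_or_exists_first_one (α : ℕ → Bool) :
    (∀ i, α i = false) ∨ ∃ n, (∀ i < n, α i = false) ∧ α n = true := by
  classical
  by_cases h : ∃ n, α n = true
  · exact .inr ⟨Nat.find h, fun i hi => by simpa using Nat.find_min h hi, Nat.find_spec h⟩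
  · exact .inl fun i => by simpa using fun hi => h ⟨i, hi⟩

/-- The Cantor points `cantorPoint α`, `cantorPoint (flipAfter α)` either are both `0` or lie in
one interval `[2 / 3 ^ (n + 1), 1 / 3 ^ n]`, symmetrically about its centre. -/
theorem cantorPoint_flipAfter (α : ℕ → Bool) :
    (cantorPoint α = 0 ∧ cantorPoint (flipAfter α) = 0) ∨
      ∃ n : ℕ, cantorPoint α ∈ Icc (2 * ((3 : ℝ) ^ (n + 1))⁻¹) (3 * ((3 : ℝ) ^ (n + 1))⁻¹) ∧
        cantorPoint (flipAfter α) ∈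
          Icc (2 * ((3 : ℝ) ^ (n + 1))⁻¹) (3 * ((3 : ℝ) ^ (n + 1))⁻¹) ∧
        cantorPoint α + cantorPoint (flipAfter α) = 5 * ((3 : ℝ) ^ (n + 1))⁻¹ := by
  rcases eq_zero_or_exists_first_one α with h | ⟨n, h0, h1⟩
  · left
    have h' : flipAfter α = α := by
      funext i
      simp [flipAfter, seen_eq_false fun j (_ : j < i) => h j]
    rw [h', and_self]
    simp [cantorPoint, h, Real.ofDigits, Real.ofDigitsTerm]
  · right
    obtain ⟨g0, g1, g2⟩ := flipAfter_apply_of_first_one h0 h1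
    have hs : (fun i => flipAfter α (i + (n + 1))) = flip fun i => α (i + (n + 1)) := by
      funext i
      exact g2 _ (by omega)
    have ha := cantorPoint_of_first_one h0 h1
    have hb := cantorPoint_of_first_one g0 g1
    rw [hs] at hb
    set γ : ℕ → Bool := fun i => α (i + (n + 1))
    have h3 : 0 < ((3 : ℝ) ^ (n + 1))⁻¹ := by positivity
    have e := cantorPoint_add_flip γ
    have l := cantorPoint_nonneg γ
    have u := cantorPoint_le_one γ
    have e' : cantorPoint (flip γ) = 1 - cantorPoint γ := by linarith
    rw [e'] at hb
    refine ⟨n, ⟨?_, ?_⟩, ⟨?_, ?_⟩, ?_⟩ <;> simp only [ha, hb] <;> nlinarith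

/-- Two pairs `{α, σ α}` and `{β, σ β}` whose Cantor points span overlapping intervals have the
same centre. -/
def Nested (σ : (ℕ → Bool) → ℕ → Bool) : Prop :=
  ∀ α β x, cantorPoint α ≤ x → x ≤ cantorPoint (σ α) → cantorPoint (σ β) ≤ x →
    x ≤ cantorPoint β → cantorPoint α + cantorPoint (σ α) = cantorPoint β + cantorPoint (σ β)

theorem nested_flip : Nested flip := fun α β _ _ _ _ _ => by
  rw [cantorPoint_add_flip, cantorPoint_add_flip]

theorem nested_flipAfter : Nested flipAfter := by
  intro α β x h1 h2 h3 h4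
  have key : ∀ n m : ℕ, n < m → 3 * ((3 : ℝ) ^ (m + 1))⁻¹ < 2 * ((3 : ℝ) ^ (n + 1))⁻¹ := by
    intro n m h
    have hle : ((3 : ℝ) ^ (m + 1))⁻¹ ≤ ((3 : ℝ) ^ (n + 1 + 1))⁻¹ := by
      gcongr
      · norm_num
      · omega
    have : ((3 : ℝ) ^ (n + 1 + 1))⁻¹ = ((3 : ℝ) ^ (n + 1))⁻¹ / 3 := by
      rw [pow_succ _ (n + 1)]; field_simp
    have h3 : 0 < ((3 : ℝ) ^ (n + 1))⁻¹ := by positivity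
    linarith
  have pos : ∀ n : ℕ, 0 < ((3 : ℝ) ^ (n + 1))⁻¹ := fun n => by positivity
  rcases cantorPoint_flipAfter α with ⟨a1, a2⟩ | ⟨n, a1, a2, a3⟩ <;>
    rcases cantorPoint_flipAfter β with ⟨b1, b2⟩ | ⟨m, b1, b2, b3⟩
  · linarith
  · linarith [b2.1, pos m]
  · linarith [a1.1, pos n]
  · rcases lt_trichotomy n m with h | rfl | h
    · linarith [key n m h, a1.1, b1.2]
    · linarith
    · linarith [key m n h, a2.2, b2.1]

/-- The arc issuing from `(cantorPoint α, -e)`: for `t ≤ 1` it is vertical, and for `1 ≤ t ≤ 2`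
it runs diagonally until it meets the arc issuing from `(cantorPoint (σ α), -e)`. -/
noncomputable def arc (e : ℝ) (σ : (ℕ → Bool) → ℕ → Bool) (p : (ℕ → Bool) × ℝ) : ℝ × ℝ :=
  (cantorPoint p.1 + max (p.2 - 1) 0 * ((cantorPoint (σ p.1) - cantorPoint p.1) / 2),
    e * (min p.2 1 + max (p.2 - 1) 0 * (|cantorPoint (σ p.1) - cantorPoint p.1| / 2)))

theorem continuous_arc (e : ℝ) {σ : (ℕ → Bool) → ℕ → Bool} (hσ : Continuous σ) :
    Continuous (arc e σ) := by
  have h1 : Continuous fun p : (ℕ → Bool) × ℝ => cantorPoint p.1 :=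
    continuous_cantorPoint.comp continuous_fst
  have h2 : Continuous fun p : (ℕ → Bool) × ℝ => cantorPoint (σ p.1) :=
    continuous_cantorPoint.comp (hσ.comp continuous_fst)
  unfold arc
  fun_prop

theorem arc_zero (e : ℝ) (σ : (ℕ → Bool) → ℕ → Bool) (α : ℕ → Bool) :
    arc e σ (α, 0) = (cantorPoint α, 0) := by
  simp [arc]

theorem arc_two (e : ℝ) {σ : (ℕ → Bool) → ℕ → Bool} (hσ : Involutive σ) (α : ℕ → Bool) :
    arc e σ (σ α, 2) = arc e σ (α, 2) := by
  simp only [arc, hσ α, abs_sub_comm (cantorPoint α)]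
  norm_num
  ring

theorem height_cases (d t : ℝ) :
    (t ≤ 1 ∧ min t 1 + max (t - 1) 0 * d ≤ 1 ∧ max (t - 1) 0 = 0 ∧
      min t 1 + max (t - 1) 0 * d = t) ∨
    (1 < t ∧ min t 1 + max (t - 1) 0 * d = 1 + (t - 1) * d ∧ max (t - 1) 0 = t - 1) := by
  rcases le_or_gt t 1 with h | h
  · left
    rw [min_eq_left h, max_eq_right (by linarith)]
    simp [h]
  · right
    rw [min_eq_right h.le, max_eq_left (by linarith)]
    simp [h]

theorem arc_fst_of_height_le {e : ℝ} {σ : (ℕ → Bool) → ℕ → Bool} {α : ℕ → Bool} {t : ℝ}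
    (h : min t 1 + max (t - 1) 0 * (|cantorPoint (σ α) - cantorPoint α| / 2) ≤ 1) :
    (arc e σ (α, t)).1 = cantorPoint α := by
  simp only [arc]
  rcases height_cases (|cantorPoint (σ α) - cantorPoint α| / 2) t with
    ⟨_, _, h3, _⟩ | ⟨h1, h2, _⟩
  · simp [h3]
  · have : |cantorPoint (σ α) - cantorPoint α| = 0 := by
      rw [h2] at h
      have := abs_nonneg (cantorPoint (σ α) - cantorPoint α)
      nlinarith
    simp [abs_eq_zero.mp this]

theorem neg_one_le_height {t d : ℝ} (ht : -1 ≤ t) (hd : 0 ≤ d) :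
    -1 ≤ min t 1 + max (t - 1) 0 * d := by
  have h1 : -1 ≤ min t 1 := le_min ht (by norm_num)
  have h2 : 0 ≤ max (t - 1) 0 * d := by positivity
  linarith

theorem arc_eq_arc {e : ℝ} (he : e ≠ 0) {σ : (ℕ → Bool) → ℕ → Bool} (hσ : Nested σ)
    (α β : ℕ → Bool) {t r : ℝ} (ht : t ≤ 2) (hr : r ≤ 2)
    (h : arc e σ (α, t) = arc e σ (β, r)) : β = α ∨ β = σ α := by
  have hy := mul_left_cancel₀ he (congrArg Prod.snd h)
  have hx := congrArg Prod.fst h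
  dsimp only at hy
  by_cases hle : min t 1 + max (t - 1) 0 * (|cantorPoint (σ α) - cantorPoint α| / 2) ≤ 1
  · rw [arc_fst_of_height_le hle, arc_fst_of_height_le (hy ▸ hle)] at hx
    exact .inl (cantorPoint_injective hx.symm)
  rcases height_cases (|cantorPoint (σ α) - cantorPoint α| / 2) t with
    ⟨_, h2, _⟩ | ⟨h1, h2, h3⟩
  · exact absurd h2 hle
  rcases height_cases (|cantorPoint (σ β) - cantorPoint β| / 2) r with
    ⟨_, h2', _⟩ | ⟨h1', h2', h3'⟩
  · exact absurd h2' (hy ▸ hle)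
  simp only [arc, h3, h3'] at hx
  rw [h2, h2'] at hy
  have nest := hσ α β
  have nest' := hσ β α
  have inj {γ δ : ℕ → Bool} (h : cantorPoint γ = cantorPoint δ) : γ = δ := cantorPoint_injective h
  rcases le_total (cantorPoint α) (cantorPoint (σ α)) with ha | ha <;>
    rcases le_total (cantorPoint β) (cantorPoint (σ β)) with hb | hb
  · rw [abs_of_nonneg (by linarith), abs_of_nonneg (by linarith)] at hy
    exact .inl (inj (by linarith))
  · rw [abs_of_nonneg (by linarith), abs_of_nonpos (by linarith)] at hy
    right
    have n := nest (cantorPoint α + (t - 1) * ((cantorPoint (σ α) - cantorPoint α) / 2))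
      (by nlinarith) (by nlinarith) (by nlinarith) (by nlinarith)
    apply inj
    nlinarith
  · rw [abs_of_nonpos (by linarith), abs_of_nonneg (by linarith)] at hy
    right
    have n := nest' (cantorPoint α + (t - 1) * ((cantorPoint (σ α) - cantorPoint α) / 2))
      (by nlinarith) (by nlinarith) (by nlinarith) (by nlinarith)
    apply inj
    nlinarith
  · rw [abs_of_nonpos (by linarith), abs_of_nonpos (by linarith)] at hy
    exact .inl (inj (by linarith))

/-- If a continuous map on `Z × K` with `Z` zero-dimensional identifies only points over a common
orbit of the involution `σ` of `Z`, then a connected subset of its image lies over one orbit. -/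
theorem eq_or_eq_of_isPreconnected {Z T Y : Type*} [TopologicalSpace Z] [TopologicalSpace T]
    [TopologicalSpace Y] [CompactSpace Z] [TotallySeparatedSpace Z] [T2Space Y] {E : Z × T → Y}
    (hE : Continuous E) {K : Set T} (hK : IsCompact K) {σ : Z → Z} (hσ : Continuous σ)
    (hinv : Involutive σ)
    (hinj : ∀ a b, ∀ t ∈ K, ∀ r ∈ K, E (a, t) = E (b, r) → b = a ∨ b = σ a)
    {S : Set Y} (hS : IsPreconnected S) (hsub : S ⊆ E '' (univ ×ˢ K)) {a b : Z} {t r : T}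
    (ht : t ∈ K) (hr : r ∈ K) (hat : E (a, t) ∈ S) (hbr : E (b, r) ∈ S) : b = a ∨ b = σ a := by
  by_contra! hne
  obtain ⟨U, hU, hbU, haU⟩ := exists_isClopen_of_totally_separated hne.1
  obtain ⟨V, hV, hbV, haV⟩ := exists_isClopen_of_totally_separated hne.2
  set B := (U ∩ V) ∪ σ ⁻¹' (U ∩ V) with hB
  have hBc : IsClopen B := (hU.inter hV).union ((hU.inter hV).preimage hσ)
  have hBσ : ∀ z, z ∈ B → σ z ∈ B := by
    rintro z (hz | hz)
    · exact .inr (by simpa [hinv z] using hz)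
    · exact .inl hz
  have hbB : b ∈ B := .inl ⟨hbU, hbV⟩
  have haB : a ∉ B := by
    rintro (hz | hz)
    · exact haU hz.1
    · exact haV hz.2
  have hc : ∀ A : Set Z, IsClosed A → IsClosed (E '' (A ×ˢ K)) := fun A hA =>
    ((hA.isCompact.prod hK).image hE).isClosed
  obtain ⟨y, -, ⟨⟨z, q⟩, hz, hzy⟩, ⟨⟨w, s⟩, hw, hwy⟩⟩ :=
    isPreconnected_closed_iff.mp hS _ _ (hc B hBc.isClosed) (hc Bᶜ hBc.compl.isClosed)
      (by rwa [← image_union, ← union_prod, union_compl_self])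
      ⟨_, hbr, (b, r), ⟨hbB, hr⟩, rfl⟩ ⟨_, hat, (a, t), ⟨haB, ht⟩, rfl⟩
  rcases hinj z w q hz.2 s hw.2 (hzy.trans hwy.symm) with rfl | rfl
  · exact hw.1 hz.1
  · exact hw.1 (hBσ _ hz.1)

/-- Eventual equality up to flipping all digits. -/
def tailSetoid : Setoid (ℕ → Bool) where
  r α β := ∃ b : Bool, ∃ n, ∀ m ≥ n, α m = xor b (β m)
  iseqv := by
    refine ⟨fun α => ⟨false, 0, by simp⟩, ?_, ?_⟩
    · rintro α β ⟨b, n, h⟩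
      exact ⟨b, n, fun m hm => by simp [h m hm]⟩
    · rintro α β γ ⟨b, n, h⟩ ⟨c, k, g⟩
      exact ⟨xor b c, max n k, fun m hm => by
        rw [h m (le_of_max_le_left hm), g m (le_of_max_le_right hm), Bool.xor_assoc]⟩

theorem tailSetoid_flip (α : ℕ → Bool) : tailSetoid (flip α) α :=
  ⟨true, 0, fun m _ => by simp [flip]⟩

theorem tailSetoid_flipAfter (α : ℕ → Bool) : tailSetoid (flipAfter α) α := by
  rcases eq_zero_or_exists_first_one α with h | ⟨n, h0, h1⟩
  · exact ⟨false, 0, fun m _ => by simp [flipAfter, seen_eq_false fun j (_ : j < m) => h j]⟩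
  · refine ⟨true, n + 1, fun m hm => ?_⟩
    rw [(flipAfter_apply_of_first_one h0 h1).2.2 m (by omega)]
    simp

/-- An equivalence relation invariant under `flip` and `flipAfter` contains `tailSetoid`. -/
theorem rel_of_tailSetoid (s : Setoid (ℕ → Bool)) (h1 : ∀ α, s α (flip α))
    (h2 : ∀ α, s α (flipAfter α)) {α β : ℕ → Bool} (h : tailSetoid α β) : s α β := by
  obtain ⟨b, n, h⟩ := h
  induction n generalizing α β b with
  | zero =>
    cases b
    · rw [show α = β from funext fun m => by simpa using h m (Nat.zero_le m)]
    · rw [show α = flip β from funext fun m => by simpa [flip] using h m (Nat.zero_le m)]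
      exact s.symm (h1 β)
  | succ n ih =>
    have main : ∀ α β : ℕ → Bool, (∀ m ≥ n + 1, α m = β m) → α n = false → β n = true →
        s α β := by
      intro α β h hα hβ
      set δ : ℕ → Bool := fun i => if i < n then false else β i with hδ
      have hδn : δ n = true := by simp [hδ, hβ]
      obtain ⟨g0, g1, g2⟩ := flipAfter_apply_of_first_one (α := δ) (n := n)
        (fun i hi => by simp [hδ, hi]) hδn
      have e1 : s α (flipAfter δ) := by
        refine ih true fun m hm => ?_
        rcases hm.eq_or_lt with rfl | hm
        · simp [g1, hα]
        · rw [g2 m hm, h m hm]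
          simp [hδ, hm.le.not_gt]
      have e2 : s δ β := ih false fun m hm => by simp [hδ, hm.not_gt]
      exact s.trans e1 (s.trans (s.symm (h2 δ)) e2)
    have eqv : ∀ α β : ℕ → Bool, (∀ m ≥ n + 1, α m = β m) → s α β := by
      intro α β h
      cases hα : α n <;> cases hβ : β n
      · exact ih false fun m hm => by
          rcases hm.eq_or_lt with rfl | hm
          · simp [hα, hβ]
          · simpa using h m hm
      · exact main α β h hα hβ
      · exact s.symm (main β α (fun m hm => (h m hm).symm) hβ hα)
      · exact ih false fun m hm => by
          rcases hm.eq_or_lt with rfl | hm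
          · simp [hα, hβ]
          · simpa using h m hm
    cases b
    · exact eqv α β fun m hm => by simpa using h m hm
    · exact s.trans (eqv α (flip β) fun m hm => by simpa [flip] using h m hm) (s.symm (h1 β))

/-- The union of the arcs bending upwards. -/
noncomputable def upper : Set (ℝ × ℝ) := arc 1 flip '' (univ ×ˢ Icc (-1) 2)

/-- The union of the arcs bending downwards. -/
noncomputable def lower : Set (ℝ × ℝ) := arc (-1) flipAfter '' (univ ×ˢ Icc (-1) 2)

/-- A copy of the Knaster continuum in the plane. -/
noncomputable def continuum : Set (ℝ × ℝ) := upper ∪ lower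

theorem isCompact_continuum : IsCompact continuum :=
  ((isCompact_univ.prod isCompact_Icc).image (continuous_arc 1 continuous_flip)).union
    ((isCompact_univ.prod isCompact_Icc).image (continuous_arc (-1) continuous_flipAfter))

/-- The point `p` lies on one of the two arcs through `(cantorPoint α, 0)`. -/
def OnArc (p : ℝ × ℝ) (α : ℕ → Bool) : Prop :=
  ∃ t ∈ Icc (-1 : ℝ) 2, arc 1 flip (α, t) = p ∨ arc (-1) flipAfter (α, t) = p

theorem exists_onArc {p : ℝ × ℝ} (hp : p ∈ continuum) : ∃ α, OnArc p α := by
  rcases hp with ⟨⟨α, t⟩, ht, h⟩ | ⟨⟨α, t⟩, ht, h⟩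
  · exact ⟨α, t, ht.2, .inl h⟩
  · exact ⟨α, t, ht.2, .inr h⟩

theorem eq_of_arc_eq_arc {σ τ : (ℕ → Bool) → ℕ → Bool} {α β : ℕ → Bool} {t r : ℝ}
    (ht : -1 ≤ t) (hr : -1 ≤ r) (h : arc 1 σ (α, t) = arc (-1) τ (β, r)) : α = β := by
  have hy := congrArg Prod.snd h
  have hx := congrArg Prod.fst h
  have k1 := neg_one_le_height (d := |cantorPoint (σ α) - cantorPoint α| / 2) ht (by positivity)
  have k2 := neg_one_le_height (d := |cantorPoint (τ β) - cantorPoint β| / 2) hr (by positivity)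
  simp only [arc] at hy
  rw [arc_fst_of_height_le (by linarith), arc_fst_of_height_le (by linarith)] at hx
  exact cantorPoint_injective hx

/-- On the strip `-1 < y < 1` the arcs in both directions are the same vertical segments. -/
theorem arc_eq_arc_neg {e : ℝ} {σ τ : (ℕ → Bool) → ℕ → Bool} {α : ℕ → Bool} {t : ℝ}
    (ht : t ∈ Icc (-1 : ℝ) 2)
    (h : min t 1 + max (t - 1) 0 * (|cantorPoint (σ α) - cantorPoint α| / 2) < 1) :
    -t ∈ Icc (-1 : ℝ) 2 ∧ arc (-e) τ (α, -t) = arc e σ (α, t) := by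
  have ht1 : t ≤ 1 := by
    by_contra! h1
    rw [min_eq_right h1.le] at h
    have : 0 ≤ max (t - 1) 0 * (|cantorPoint (σ α) - cantorPoint α| / 2) := by positivity
    linarith
  have h1 : -t ≤ 1 := by linarith [ht.1]
  refine ⟨⟨by linarith, by linarith⟩, ?_⟩
  simp only [arc]
  rw [min_eq_left ht1, min_eq_left h1, max_eq_right (by linarith), max_eq_right (by linarith)]
  simp

theorem OnArc.exists_up {p : ℝ × ℝ} {α : ℕ → Bool} (h : OnArc p α) (hp : -1 < p.2) :
    ∃ t ∈ Icc (-1 : ℝ) 2, arc 1 flip (α, t) = p := by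
  obtain ⟨t, ht, rfl | rfl⟩ := h
  · exact ⟨t, ht, rfl⟩
  · simp only [arc] at hp
    have := arc_eq_arc_neg (e := -1) (σ := flipAfter) (τ := flip) (α := α) ht (by linarith)
    rw [neg_neg] at this
    exact ⟨-t, this⟩

theorem OnArc.exists_down {p : ℝ × ℝ} {α : ℕ → Bool} (h : OnArc p α) (hp : p.2 < 1) :
    ∃ t ∈ Icc (-1 : ℝ) 2, arc (-1) flipAfter (α, t) = p := by
  obtain ⟨t, ht, rfl | rfl⟩ := h
  · simp only [arc] at hp
    exact ⟨-t, arc_eq_arc_neg (e := 1) (σ := flip) (τ := flipAfter) (α := α) ht (by linarith)⟩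
  · exact ⟨t, ht, rfl⟩

theorem tailSetoid_of_isPreconnected_up {S : Set (ℝ × ℝ)} (hS : IsPreconnected S)
    (hsub : S ⊆ continuum) (hy : ∀ p ∈ S, -1 < p.2) {p q : ℝ × ℝ} (hp : p ∈ S) (hq : q ∈ S)
    {α β : ℕ → Bool} (hα : OnArc p α) (hβ : OnArc q β) : tailSetoid β α := by
  obtain ⟨t, ht, rfl⟩ := hα.exists_up (hy p hp)
  obtain ⟨r, hr, rfl⟩ := hβ.exists_up (hy q hq)
  have hsub' : S ⊆ arc 1 flip '' (univ ×ˢ Icc (-1) 2) := by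
    intro p hp
    obtain ⟨γ, hγ⟩ := exists_onArc (hsub hp)
    obtain ⟨u, hu, h⟩ := hγ.exists_up (hy p hp)
    exact ⟨(γ, u), ⟨mem_univ _, hu⟩, h⟩
  rcases eq_or_eq_of_isPreconnected (continuous_arc 1 continuous_flip) isCompact_Icc
    continuous_flip flip_involutive
    (fun a b t ht r hr h => arc_eq_arc one_ne_zero nested_flip a b ht.2 hr.2 h)
    hS hsub' ht hr hp hq with rfl | rfl
  · exact tailSetoid.refl _
  · exact tailSetoid_flip _

theorem tailSetoid_of_isPreconnected_down {S : Set (ℝ × ℝ)} (hS : IsPreconnected S)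
    (hsub : S ⊆ continuum) (hy : ∀ p ∈ S, p.2 < 1) {p q : ℝ × ℝ} (hp : p ∈ S) (hq : q ∈ S)
    {α β : ℕ → Bool} (hα : OnArc p α) (hβ : OnArc q β) : tailSetoid β α := by
  obtain ⟨t, ht, rfl⟩ := hα.exists_down (hy p hp)
  obtain ⟨r, hr, rfl⟩ := hβ.exists_down (hy q hq)
  have hsub' : S ⊆ arc (-1) flipAfter '' (univ ×ˢ Icc (-1) 2) := by
    intro p hp
    obtain ⟨γ, hγ⟩ := exists_onArc (hsub hp)
    obtain ⟨u, hu, h⟩ := hγ.exists_down (hy p hp)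
    exact ⟨(γ, u), ⟨mem_univ _, hu⟩, h⟩
  rcases eq_or_eq_of_isPreconnected (continuous_arc (-1) continuous_flipAfter) isCompact_Icc
    continuous_flipAfter flipAfter_involutive
    (fun a b t ht r hr h => arc_eq_arc (by norm_num) nested_flipAfter a b ht.2 hr.2 h)
    hS hsub' ht hr hp hq with rfl | rfl
  · exact tailSetoid.refl _
  · exact tailSetoid_flipAfter _

theorem tailSetoid_of_onArc {p : ℝ × ℝ} {α β : ℕ → Bool} (hα : OnArc p α) (hβ : OnArc p β) :
    tailSetoid α β := by
  obtain ⟨t, ht, rfl | rfl⟩ := hα <;> obtain ⟨r, hr, h | h⟩ := hβ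
  · rcases arc_eq_arc one_ne_zero nested_flip _ _ hr.2 ht.2 h with rfl | rfl
    · exact tailSetoid.refl _
    · exact tailSetoid_flip _
  · rw [eq_of_arc_eq_arc ht.1 hr.1 h.symm]
  · rw [eq_of_arc_eq_arc hr.1 ht.1 h]
  · rcases arc_eq_arc (by norm_num) nested_flipAfter _ _ hr.2 ht.2 h with
      rfl | rfl
    · exact tailSetoid.refl _
    · exact tailSetoid_flipAfter _

theorem onArc_cantorPoint (α : ℕ → Bool) : OnArc (cantorPoint α, 0) α :=
  ⟨0, by norm_num, .inl (arc_zero 1 flip α)⟩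

theorem cantorPoint_mem_continuum (α : ℕ → Bool) : (cantorPoint α, (0 : ℝ)) ∈ continuum :=
  .inl ⟨(α, 0), ⟨mem_univ _, by norm_num⟩, arc_zero 1 flip α⟩

theorem tailSetoid_of_joinedIn {α β : ℕ → Bool}
    (h : JoinedIn continuum (cantorPoint α, 0) (cantorPoint β, 0)) : tailSetoid α β := by
  obtain ⟨γ, hγ⟩ := h
  set g := γ.extend with hg
  have hgH : ∀ s, g s ∈ continuum := fun s => by
    obtain ⟨u, hu⟩ := γ.extend_range ▸ mem_range_self (f := g) s
    exact hu ▸ hγ u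
  choose a ha using fun s => exists_onArc (hgH s)
  have hloc : IsLocallyConstant fun s => Quotient.mk tailSetoid (a s) := by
    rw [IsLocallyConstant.iff_eventually_eq]
    intro s
    have hnhds : ∀ V : Set ℝ, IsOpen V → s ∈ V →
        ∃ N ∈ 𝓝 s, N ⊆ V ∧ IsPreconnected (g '' N) := fun V hV hs =>
      ⟨connectedComponentIn V s, hV.connectedComponentIn.mem_nhds (mem_connectedComponentIn hs),
        connectedComponentIn_subset V s,
        isPreconnected_connectedComponentIn.image g g.continuous.continuousOn⟩
    have hy : Continuous fun s => (g s).2 := continuous_snd.comp g.continuous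
    have hrange : ∀ N : Set ℝ, g '' N ⊆ continuum := by
      rintro N _ ⟨s, -, rfl⟩
      exact hgH s
    rcases lt_or_ge (-1) (g s).2 with h | h
    · obtain ⟨N, hN, hNV, hpre⟩ := hnhds _ (isOpen_Ioi.preimage hy) h
      filter_upwards [hN] with s' hs'
      refine Quotient.sound (tailSetoid_of_isPreconnected_up hpre (hrange N) ?_
        (mem_image_of_mem g (mem_of_mem_nhds hN)) (mem_image_of_mem g hs') (ha s) (ha s'))
      rintro _ ⟨u, hu, rfl⟩
      exact hNV hu
    · obtain ⟨N, hN, hNV, hpre⟩ := hnhds _ (isOpen_Iio.preimage hy)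
        (show (g s).2 < 1 by linarith)
      filter_upwards [hN] with s' hs'
      refine Quotient.sound (tailSetoid_of_isPreconnected_down hpre (hrange N) ?_
        (mem_image_of_mem g (mem_of_mem_nhds hN)) (mem_image_of_mem g hs') (ha s) (ha s'))
      rintro _ ⟨u, hu, rfl⟩
      exact hNV hu
  have h01 : tailSetoid (a 0) (a 1) := Quotient.exact (hloc.apply_eq_of_preconnectedSpace 0 1)
  have h0 : OnArc (cantorPoint α, 0) (a 0) := by simpa [hg] using ha 0
  have h1 : OnArc (cantorPoint β, 0) (a 1) := by simpa [hg] using ha 1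
  exact tailSetoid.trans (tailSetoid_of_onArc (onArc_cantorPoint α) h0)
    (tailSetoid.trans h01 (tailSetoid_of_onArc h1 (onArc_cantorPoint β)))

theorem joinedIn_involution {e : ℝ} {σ : (ℕ → Bool) → ℕ → Bool} (hσ : Continuous σ)
    (hinv : Involutive σ) (α : ℕ → Bool) :
    JoinedIn (arc e σ '' (univ ×ˢ Icc (-1) 2)) (cantorPoint α, 0) (cantorPoint (σ α), 0) := by
  have half : ∀ α, JoinedIn (arc e σ '' (univ ×ˢ Icc (-1) 2)) (cantorPoint α, 0)
      (arc e σ (α, 2)) := by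
    intro α
    have hpc : IsPathConnected ((fun t : ℝ => arc e σ (α, t)) '' Icc (-1) 2) :=
      ((convex_Icc _ _).isPathConnected ⟨0, by norm_num⟩).image
        ((continuous_arc e hσ).comp (by fun_prop))
    have := hpc.joinedIn _ (mem_image_of_mem _ (show (0 : ℝ) ∈ Icc (-1) 2 by norm_num)) _
      (mem_image_of_mem _ (show (2 : ℝ) ∈ Icc (-1) 2 by norm_num))
    rw [arc_zero] at this
    refine this.mono ?_
    rintro _ ⟨t, ht, rfl⟩
    exact ⟨(α, t), ⟨mem_univ _, ht⟩, rfl⟩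
  refine (half α).trans ?_
  rw [← arc_two e hinv]
  exact (half (σ α)).symm

theorem joinedIn_iff_tailSetoid {α β : ℕ → Bool} :
    JoinedIn continuum (cantorPoint α, 0) (cantorPoint β, 0) ↔ tailSetoid α β := by
  refine ⟨tailSetoid_of_joinedIn, fun h => ?_⟩
  let s : Setoid (ℕ → Bool) :=
    { r := fun α β => JoinedIn continuum (cantorPoint α, 0) (cantorPoint β, 0)
      iseqv := ⟨fun α => JoinedIn.refl (cantorPoint_mem_continuum α), JoinedIn.symm,
        JoinedIn.trans⟩ }
  exact rel_of_tailSetoid s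
    (fun α => (joinedIn_involution continuous_flip flip_involutive α).mono subset_union_left)
    (fun α => (joinedIn_involution continuous_flipAfter flipAfter_involutive α).mono
      subset_union_right) h

/-- Interleaves `α` with zeros. -/
def interleave (α : ℕ → Bool) : ℕ → Bool := fun i => decide (i % 2 = 1) && α (i / 2)

theorem continuous_interleave : Continuous interleave :=
  continuous_pi fun i =>
    (continuous_of_discreteTopology (f := fun b : Bool => decide (i % 2 = 1) && b)).comp
      (continuous_apply (i / 2))

theorem tailSetoid_interleave_iff {α β : ℕ → Bool} :
    tailSetoid (interleave α) (interleave β) ↔ ∃ n, ∀ m ≥ n, α m = β m := by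
  constructor
  · rintro ⟨b, n, h⟩
    have hb := h (2 * n) (by omega)
    simp only [interleave, show 2 * n % 2 = 0 by omega] at hb
    obtain rfl : b = false := by simpa using hb.symm
    refine ⟨n, fun m hm => ?_⟩
    have := h (2 * m + 1) (by omega)
    simpa [interleave, show (2 * m + 1) % 2 = 1 by omega, show (2 * m + 1) / 2 = m by omega]
      using this
  · rintro ⟨n, h⟩
    exact ⟨false, 2 * n, fun m hm => by simp [interleave, h (m / 2) (by omega)]⟩

end Knaster

/-- There is a compact subset `H` of the plane (e.g. the Knaster continuum) such that
the eventual equality relation `E₀` on `2^ℕ` is Borel reducible to the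
arc-connectedness (equivalently, path-connectedness) relation on `H`. -/
theorem statement5 :
    ∃ H : Set (ℝ × ℝ), IsCompact H ∧
      ∃ f : (ℕ → Bool) → H, Measurable f ∧
        ∀ α β : ℕ → Bool,
          (∃ n : ℕ, ∀ m ≥ n, α m = β m) ↔ JoinedIn H (f α).1 (f β).1 := by
  refine ⟨Knaster.continuum, Knaster.isCompact_continuum,
    fun α => ⟨(Knaster.cantorPoint (Knaster.interleave α), 0),
      Knaster.cantorPoint_mem_continuum _⟩, ?_, fun α β => ?_⟩
  · refine (Continuous.subtype_mk ?_ _).measurable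
    exact (Knaster.continuous_cantorPoint.comp Knaster.continuous_interleave).prodMk
      continuous_const
  · exact (Knaster.joinedIn_iff_tailSetoid.trans Knaster.tailSetoid_interleave_iff).symm
end

section
/- Let K ⊆ ℝ be an interval, φ : K → ℝ² a continuous injective map, and C = φ(K); assume C is not homeomorphic to the circle. Let p < q be reals, L = {(x,y) : x = p}, R = {(x,y) : x = q}, and let 𝒥 be the set of all arcs J ⊆ C with J ∩ L = {e₁(J)} and J ∩ R = {e₂(J)}. Let J, J' ∈ 𝒥 be distinct, with φ⁻¹(J) = [a,b], φ⁻¹(J') = [a',b'] and b ≤ a'. Then the set {φ⁻¹(I) : I ∈ 𝒥 and φ⁻¹(I) ⊆ [b,a']} is finite. -/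
/-- `J` is an arc in the plane with endpoints `u` and `v`: the image of a continuous
injective map from the unit interval sending `0` to `u` and `1` to `v`. -/
def IsArcWith (J : Set (ℝ × ℝ)) (u v : ℝ × ℝ) : Prop :=
  ∃ f : unitInterval → ℝ × ℝ, Continuous f ∧ Function.Injective f ∧
    Set.range f = J ∧ f 0 = u ∧ f 1 = v

/-- `J` is an arc in the plane. -/
def IsArc (J : Set (ℝ × ℝ)) : Prop := ∃ u v, IsArcWith J u v

open Set

/-- A set of compact intervals of length at least `δ > 0` inside a bounded interval is finite,
provided the intervals have their endpoints, but no interior points, in a fixed set `M`. -/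
theorem finite_setOf_Icc_of_length_ge {b c δ : ℝ} (hδ : 0 < δ) (M : Set ℝ) :
    {I : ℝ × ℝ | b ≤ I.1 ∧ I.2 ≤ c ∧ I.1 + δ ≤ I.2 ∧ I.1 ∈ M ∧ I.2 ∈ M ∧
      ∀ x ∈ Icc I.1 I.2, x ∈ M → x = I.1 ∨ x = I.2}.Finite := by
  refine Set.Finite.of_injOn (f := fun I : ℝ × ℝ => ⌊I.1 / δ⌋) (t := Icc ⌊b / δ⌋ ⌊c / δ⌋)
    ?_ ?_ (Set.finite_Icc _ _)
  · rintro ⟨s, t⟩ ⟨h1, h2, h3, -⟩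
    simp only at h1 h2 h3
    exact ⟨Int.floor_le_floor (by gcongr), Int.floor_le_floor (by gcongr; linarith)⟩
  · rintro ⟨s, t⟩ ⟨-, -, h3, h4, h5, h6⟩ ⟨s', t'⟩ ⟨-, -, h3', h4', h5', h6'⟩ h
    simp only at h3 h4 h5 h6 h3' h4' h5' h6' h
    have habs := Int.abs_sub_lt_one_of_floor_eq_floor h
    rw [← sub_div, abs_div, abs_of_pos hδ, div_lt_one hδ, abs_lt] at habs
    have hs : s = s' := by
      rcases le_total s s' with hle | hle
      · rcases h6 s' ⟨hle, by linarith⟩ h4' with h | h <;> linarith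
      · rcases h6' s ⟨hle, by linarith⟩ h4 with h | h <;> linarith
    have ht : t = t' := by
      rcases le_total t t' with hle | hle
      · rcases h6' t ⟨by linarith, hle⟩ h5 with h | h <;> linarith
      · rcases h6 t' ⟨by linarith, hle⟩ h5' with h | h <;> linarith
    rw [hs, ht]

/-- An arc contained in the image of a compact interval under a continuous injective map is the
image of a compact subinterval, with endpoints corresponding to endpoints. -/
theorem IsArcWith.exists_preimage_Icc {φ : ℝ → ℝ × ℝ} {b c : ℝ} (hφ : ContinuousOn φ (Icc b c))
    (hinj : InjOn φ (Icc b c)) {I : Set (ℝ × ℝ)} {u v : ℝ × ℝ} (hI : IsArcWith I u v)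
    (hsub : I ⊆ φ '' Icc b c) :
    ∃ s t, s ≤ t ∧ Icc b c ∩ φ ⁻¹' I = Icc s t ∧
      (φ s = u ∧ φ t = v ∨ φ s = v ∧ φ t = u) := by
  obtain ⟨f, hf, hfinj, rfl, rfl, rfl⟩ := hI
  have hex : ∀ x, ∃ y : Icc b c, φ y = f x := fun x => by
    obtain ⟨y, hy, h⟩ := hsub (mem_range_self x)
    exact ⟨⟨y, hy⟩, h⟩
  choose g hg using hex
  have hemb : Topology.IsClosedEmbedding ((Icc b c).domRestrict φ) :=
    hφ.domRestrict.isClosedEmbedding (injOn_iff_injective.mp hinj)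
  have hgc : Continuous g := by
    rw [hemb.isInducing.continuous_iff]
    exact hf.congr fun x => (hg x).symm
  have hgc' : Continuous fun x => (g x : ℝ) := continuous_subtype_val.comp hgc
  have hginj : Function.Injective fun x => (g x : ℝ) := fun x y h => hfinj (by
    rw [← hg, ← hg]
    exact congrArg φ h)
  have hrange : Icc b c ∩ φ ⁻¹' range f = range fun x => (g x : ℝ) := by
    ext y
    constructor
    · rintro ⟨hy, x, hx⟩
      exact ⟨x, hinj (g x).2 hy ((hg x).trans hx)⟩
    · rintro ⟨x, rfl⟩
      exact ⟨(g x).2, x, (hg x).symm⟩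
  have hconn : OrdConnected (range fun x => (g x : ℝ)) :=
    (isPreconnected_range hgc').ordConnected
  rw [hrange]
  rcases hgc'.strictMono_of_inj_boundedOrder' hginj with hm | hm
  · refine ⟨g 0, g 1, hm.monotone zero_le_one, Subset.antisymm ?_ ?_, Or.inl ⟨hg 0, hg 1⟩⟩
    · rintro _ ⟨x, rfl⟩
      exact ⟨hm.monotone unitInterval.nonneg', hm.monotone unitInterval.le_one'⟩
    · exact hconn.out (mem_range_self 0) (mem_range_self 1)
  · refine ⟨g 1, g 0, hm.antitone zero_le_one, Subset.antisymm ?_ ?_, Or.inr ⟨hg 1, hg 0⟩⟩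
    · rintro _ ⟨x, rfl⟩
      exact ⟨hm.antitone unitInterval.le_one', hm.antitone unitInterval.nonneg'⟩
    · exact hconn.out (mem_range_self 1) (mem_range_self 0)

/-- Let `C = φ(K)` be the continuous injective image of a real interval `K`, not
homeomorphic to the circle, and let `𝒥` be the family of arcs `J ⊆ C` meeting the
vertical lines `x = p` and `x = q` exactly in their endpoints. If `J, J' ∈ 𝒥` are
distinct with `φ⁻¹(J) = [a,b]`, `φ⁻¹(J') = [a',b']` and `b ≤ a'`, then only finitely
many preimages `φ⁻¹(I)` of members `I ∈ 𝒥` are contained in `[b, a']`. -/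
theorem statement7 (K : Set ℝ) (hK : K.OrdConnected)
    (φ : ℝ → ℝ × ℝ) (hφcont : ContinuousOn φ K) (hφinj : Set.InjOn φ K)
    (C : Set (ℝ × ℝ)) (hC : C = φ '' K)
    (hnotcircle : ¬ Nonempty (C ≃ₜ Circle))
    (p q : ℝ) (hpq : p < q)
    (𝒥 : Set (Set (ℝ × ℝ)))
    (h𝒥 : 𝒥 = {J | J ⊆ C ∧ ∃ u v, IsArcWith J u v ∧
        J ∩ {z : ℝ × ℝ | z.1 = p} = {u} ∧ J ∩ {z : ℝ × ℝ | z.1 = q} = {v}})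
    (J J' : Set (ℝ × ℝ)) (hJ : J ∈ 𝒥) (hJ' : J' ∈ 𝒥) (hne : J ≠ J')
    (a b a' b' : ℝ)
    (hJab : K ∩ φ ⁻¹' J = Set.Icc a b)
    (hJ'ab : K ∩ φ ⁻¹' J' = Set.Icc a' b')
    (hba' : b ≤ a') :
    {S : Set ℝ | ∃ I ∈ 𝒥, K ∩ φ ⁻¹' I = S ∧ S ⊆ Set.Icc b a'}.Finite := by
  have hbK : b ∈ K := by
    rw [h𝒥] at hJ
    obtain ⟨hJC, u, v, ⟨f, -, -, rfl, -⟩, -⟩ := hJ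
    obtain ⟨k, hk, hkf⟩ := hC ▸ hJC (mem_range_self 0)
    have hmem : k ∈ Icc a b := hJab ▸ ⟨hk, 0, hkf.symm⟩
    have : b ∈ Icc a b := ⟨hmem.1.trans hmem.2, le_rfl⟩
    rw [← hJab] at this
    exact this.1
  have haK : a' ∈ K := by
    rw [h𝒥] at hJ'
    obtain ⟨hJC, u, v, ⟨f, -, -, rfl, -⟩, -⟩ := hJ'
    obtain ⟨k, hk, hkf⟩ := hC ▸ hJC (mem_range_self 0)
    have hmem : k ∈ Icc a' b' := hJ'ab ▸ ⟨hk, 0, hkf.symm⟩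
    have : a' ∈ Icc a' b' := ⟨le_rfl, hmem.1.trans hmem.2⟩
    rw [← hJ'ab] at this
    exact this.1
  have hsubK : Icc b a' ⊆ K := hK.out hbK haK
  have hcont := hφcont.mono hsubK
  obtain ⟨δ, hδ, hunif⟩ := Metric.uniformContinuousOn_iff.mp
    (isCompact_Icc.uniformContinuousOn_of_continuous
      (continuous_fst.comp_continuousOn hcont)) (q - p) (sub_pos.mpr hpq)
  refine ((finite_setOf_Icc_of_length_ge (b := b) (c := a') hδ
    {x | (φ x).1 = p ∨ (φ x).1 = q}).image fun I => Icc I.1 I.2).subset ?_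
  rintro S ⟨I, hI, rfl, hS⟩
  rw [h𝒥] at hI
  obtain ⟨hIC, u, v, harc, hp, hq⟩ := hI
  have hinter : Icc b a' ∩ φ ⁻¹' I = K ∩ φ ⁻¹' I :=
    Subset.antisymm (inter_subset_inter_left _ hsubK) fun x hx => ⟨hS hx, hx.2⟩
  obtain ⟨s, t, hst, hpre, hends⟩ := harc.exists_preimage_Icc hcont (hφinj.mono hsubK)
    fun z hz => by
      obtain ⟨k, hk, rfl⟩ := hC ▸ hIC hz
      exact ⟨k, hS ⟨hk, hz⟩, rfl⟩
  have hs : s ∈ Icc b a' ∩ φ ⁻¹' I := hpre ▸ left_mem_Icc.mpr hst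
  have ht : t ∈ Icc b a' ∩ φ ⁻¹' I := hpre ▸ right_mem_Icc.mpr hst
  have hup : u.1 = p := (hp.symm ▸ mem_singleton u : u ∈ I ∩ {z : ℝ × ℝ | z.1 = p}).2
  have hvq : v.1 = q := (hq.symm ▸ mem_singleton v : v ∈ I ∩ {z : ℝ × ℝ | z.1 = q}).2
  have hmem : ∀ x ∈ Icc s t, (φ x).1 = p ∨ (φ x).1 = q → φ x = u ∨ φ x = v := by
    intro x hx
    have hxI : φ x ∈ I := (hpre.symm ▸ hx : x ∈ Icc b a' ∩ φ ⁻¹' I).2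
    exact Or.imp (fun h => (hp ▸ ⟨hxI, h⟩ : φ x ∈ ({u} : Set (ℝ × ℝ))))
      fun h => (hq ▸ ⟨hxI, h⟩ : φ x ∈ ({v} : Set (ℝ × ℝ)))
  have hlen : s + δ ≤ t := by
    by_contra! hlt
    have hd := hunif s hs.1 t ht.1 (by rw [Real.dist_eq, abs_lt]; constructor <;> linarith)
    simp only [Function.comp_apply, Real.dist_eq, abs_lt] at hd
    rcases hends with ⟨h1, h2⟩ | ⟨h1, h2⟩ <;> rw [h1, h2, hup, hvq] at hd <;> linarith [hd.1, hd.2]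
  have heq : ∀ x ∈ Icc s t, ∀ y ∈ Icc s t, φ x = φ y → x = y := by
    rw [← hpre]
    exact fun x hx y hy h => hφinj (hsubK hx.1) (hsubK hy.1) h
  refine ⟨(s, t), ⟨hs.1.1, ht.1.2, hlen, ?_, ?_, fun x hx hxM => ?_⟩, (hpre.symm.trans hinter)⟩
  · rcases hends with ⟨h1, h2⟩ | ⟨h1, h2⟩ <;> simp [h1, hup, hvq]
  · rcases hends with ⟨h1, h2⟩ | ⟨h1, h2⟩ <;> simp [h2, hup, hvq]
  · have hsx := heq x hx s (left_mem_Icc.mpr hst)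
    have htx := heq x hx t (right_mem_Icc.mpr hst)
    rcases hends with ⟨h1, h2⟩ | ⟨h1, h2⟩ <;> rw [h1] at hsx <;> rw [h2] at htx <;>
      rcases hmem x hx hxM with h | h <;> tauto
end

section
/- Let A ⊆ ℝ² be an arc with endpoints u and v, and let p, q be reals with u₁ < p < q < v₁, where u₁, v₁ are the first coordinates of u and v. Then there exists an arc J ⊆ A such that J ∩ {(x,y) : x = p} is a singleton consisting of one endpoint of J and J ∩ {(x,y) : x = q} is a singleton consisting of the other endpoint of J. -/
/-- A continuous real function on the unit interval running from below `p` to above `q` has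
parameters `a < b` such that, on `[a, b]`, it takes the value `p` only at `a` and `q` only at `b`. -/
theorem exists_lt_eq_iff_eq_on_Icc {g : unitInterval → ℝ} (hg : Continuous g) {p q : ℝ}
    (hp : g 0 < p) (hpq : p < q) (hq : q < g 1) :
    ∃ a b : unitInterval, a < b ∧
      ∀ t ∈ Set.Icc a b, (g t = p ↔ t = a) ∧ (g t = q ↔ t = b) := by
  obtain ⟨s, -, hs⟩ := intermediate_value_Icc (zero_le_one' unitInterval) hg.continuousOn
    ⟨(hp.trans hpq).le, hq.le⟩
  obtain ⟨b, hb, hb_min⟩ : ∃ b, IsLeast {t | g t = q} b :=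
    (isClosed_eq hg continuous_const).isCompact.exists_isLeast ⟨s, hs⟩
  have hb' : g b = q := hb
  obtain ⟨r, hr, hr'⟩ := intermediate_value_Icc (unitInterval.nonneg' (t := b)) hg.continuousOn
    ⟨hp.le, hb'.symm ▸ hpq.le⟩
  obtain ⟨a, ⟨ha, hab⟩, ha_max⟩ : ∃ a, IsGreatest ({t | g t = p} ∩ Set.Iic b) a :=
    ((isClosed_eq hg continuous_const).inter isClosed_Iic).isCompact.exists_isGreatest
      ⟨r, hr', hr.2⟩
  have ha' : g a = p := ha
  refine ⟨a, b, lt_of_le_of_ne hab ?_, fun t ht => ⟨⟨fun h => ?_, fun h => h ▸ ha'⟩,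
    ⟨fun h => ?_, fun h => h ▸ hb'⟩⟩⟩
  · rintro rfl
    exact hpq.ne (ha'.symm.trans hb')
  · exact le_antisymm (ha_max ⟨h, ht.2⟩) ht.1
  · exact le_antisymm ht.2 (hb_min h)

/-- For `a < b` in the unit interval there is a continuous injective map of the unit interval into
`[a, b]` sending `0` to `a` and `1` to `b`. -/
theorem exists_continuous_injective_range_subset_Icc {a b : unitInterval} (hab : a < b) :
    ∃ φ : unitInterval → unitInterval, Continuous φ ∧ Function.Injective φ ∧
      Set.range φ ⊆ Set.Icc a b ∧ φ 0 = a ∧ φ 1 = b := by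
  have hab' : (a : ℝ) < b := hab
  have mem (t : unitInterval) : (a : ℝ) + t * (b - a) ∈ Set.Icc (a : ℝ) b :=
    ⟨by nlinarith [t.2.1], by nlinarith [t.2.2]⟩
  refine ⟨fun t => ⟨a + t * (b - a), a.2.1.trans (mem t).1, (mem t).2.trans b.2.2⟩,
    by fun_prop, fun s t hst => ?_, ?_, ?_, ?_⟩
  · have h := congrArg Subtype.val hst
    simp only [add_right_inj] at h
    exact Subtype.ext (mul_right_cancel₀ (sub_pos.2 hab').ne' h)
  · rintro _ ⟨t, rfl⟩
    exact mem t
  · ext; simp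
  · ext; simp


/-- If `A` is an arc with endpoints `u`, `v` and `u₁ < p < q < v₁`, then `A` contains a
sub-arc `J` meeting the vertical line `x = p` exactly in one of its endpoints and the
vertical line `x = q` exactly in the other. -/
theorem statement11 (A : Set (ℝ × ℝ)) (u v : ℝ × ℝ) (hA : IsArcWith A u v)
    (p q : ℝ) (hup : u.1 < p) (hpq : p < q) (hqv : q < v.1) :
    ∃ J : Set (ℝ × ℝ), J ⊆ A ∧ ∃ w₁ w₂ : ℝ × ℝ, IsArcWith J w₁ w₂ ∧
      J ∩ {z : ℝ × ℝ | z.1 = p} = {w₁} ∧ J ∩ {z : ℝ × ℝ | z.1 = q} = {w₂} := by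
  obtain ⟨f, hf, hf_inj, rfl, rfl, rfl⟩ := hA
  obtain ⟨a, b, hab, h⟩ := exists_lt_eq_iff_eq_on_Icc (continuous_fst.comp hf) hup hpq hqv
  obtain ⟨φ, hφ, hφ_inj, hφ_mem, rfl, rfl⟩ := exists_continuous_injective_range_subset_Icc hab
  replace h (t : unitInterval) := h (φ t) (hφ_mem ⟨t, rfl⟩)
  refine ⟨Set.range (f ∘ φ), Set.range_comp_subset_range φ f, f (φ 0), f (φ 1),
    ⟨f ∘ φ, hf.comp hφ, hf_inj.comp hφ_inj, rfl, rfl, rfl⟩, ?_, ?_⟩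
  · refine Set.Subset.antisymm ?_ (Set.singleton_subset_iff.2 ⟨⟨0, rfl⟩, (h 0).1.2 rfl⟩)
    rintro _ ⟨⟨t, rfl⟩, ht⟩
    exact congrArg f ((h t).1.1 ht)
  · refine Set.Subset.antisymm ?_ (Set.singleton_subset_iff.2 ⟨⟨1, rfl⟩, (h 1).2.2 rfl⟩)
    rintro _ ⟨⟨t, rfl⟩, ht⟩
    exact congrArg f ((h t).2.1 ht)
end

section
/- Let A ⊆ ℝ² be an arc containing two distinct points u and v. Then there exist rationals p < q and an arc J ⊆ A such that either J ∩ {(x,y) : x = p} is a singleton consisting of one endpoint of J and J ∩ {(x,y) : x = q} is a singleton consisting of the other endpoint of J, or J ∩ {(x,y) : y = p} is a singleton consisting of one endpoint of J and J ∩ {(x,y) : y = q} is a singleton consisting of the other endpoint of J. -/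
/-- A continuous function with values below `p` at `0` and above `q` at `1` has a crossing from
level `p` to level `q` whose interior avoids both levels. -/
lemma exists_minimal_crossing {k : ℝ → ℝ} (hk : Continuous k) {p q : ℝ} (hpq : p < q)
    (h0 : k 0 < p) (h1 : q < k 1) :
    ∃ s t : ℝ, 0 ≤ s ∧ s < t ∧ t ≤ 1 ∧ k s = p ∧ k t = q ∧
      ∀ r ∈ Set.Icc s t, (k r = p → r = s) ∧ (k r = q → r = t) := by
  have level (a c : ℝ) (hac : a ≤ 1) (ha : k a ≤ c) (hc : c ≤ k 1) :
      IsCompact (Set.Icc a 1 ∩ k ⁻¹' {c}) ∧ (Set.Icc a 1 ∩ k ⁻¹' {c}).Nonempty := by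
    refine ⟨isCompact_Icc.inter_right (isClosed_singleton.preimage hk), ?_⟩
    obtain ⟨r, hr, hrc⟩ := intermediate_value_Icc hac hk.continuousOn ⟨ha, hc⟩
    exact ⟨r, hr, hrc⟩
  obtain ⟨hcs, hns⟩ := level 0 p zero_le_one h0.le (hpq.trans h1).le
  obtain ⟨s, ⟨hs, hsp⟩, hmax⟩ := hcs.exists_isGreatest hns
  have hsp : k s = p := hsp
  obtain ⟨hct, hnt⟩ := level s q hs.2 (hsp.trans_lt hpq).le h1.le
  obtain ⟨t, ⟨ht, htq⟩, hmin⟩ := hct.exists_isLeast hnt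
  have htq : k t = q := htq
  have hst : s < t := lt_of_le_of_ne ht.1 fun h => hpq.ne (by rw [← hsp, ← htq, h])
  exact ⟨s, t, hs.1, hst, ht.2, hsp, htq, fun r hr =>
    ⟨fun h => le_antisymm (hmax ⟨⟨hs.1.trans hr.1, hr.2.trans ht.2⟩, h⟩) hr.1,
     fun h => le_antisymm hr.2 (hmin ⟨⟨hr.1, hr.2.trans ht.2⟩, h⟩)⟩⟩

/-- The image of a nondegenerate segment under a path injective on it is an arc. -/
lemma isArcWith_image_Icc {γ : ℝ → ℝ × ℝ} (hγ : Continuous γ) {s t : ℝ} (hst : s < t)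
    (hinj : Set.InjOn γ (Set.Icc s t)) :
    IsArcWith (γ '' Set.Icc s t) (γ s) (γ t) := by
  let e := iccHomeoI s t hst
  refine ⟨fun r => γ (e.symm r), by fun_prop, fun x y h => ?_, ?_, ?_, ?_⟩
  · exact e.symm.injective (Subtype.ext (hinj (e.symm x).2 (e.symm y).2 h))
  · ext z
    constructor
    · rintro ⟨r, rfl⟩
      exact ⟨_, (e.symm r).2, rfl⟩
    · rintro ⟨r, hr, rfl⟩
      exact ⟨e ⟨r, hr⟩, by simp⟩
  · simp [e, iccHomeoI_symm_apply_coe]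
  · simp [e, iccHomeoI_symm_apply_coe]

/-- If a continuous function `g` takes different values at two points of an arc, some sub-arc
meets two rational level sets of `g` exactly in its two endpoints. -/
lemma IsArc.exists_subarc_of_lt {A : Set (ℝ × ℝ)} (hA : IsArc A) {g : ℝ × ℝ → ℝ}
    (hg : Continuous g) {u v : ℝ × ℝ} (hu : u ∈ A) (hv : v ∈ A) (huv : g u < g v) :
    ∃ p q : ℚ, p < q ∧ ∃ J : Set (ℝ × ℝ), J ⊆ A ∧
      ∃ w₁ w₂ : ℝ × ℝ, IsArcWith J w₁ w₂ ∧
        J ∩ {z | g z = (p : ℝ)} = {w₁} ∧ J ∩ {z | g z = (q : ℝ)} = {w₂} := by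
  obtain ⟨-, -, f, hf, hfinj, rfl, -, -⟩ := hA
  obtain ⟨a, rfl⟩ := hu
  obtain ⟨b, rfl⟩ := hv
  have hab : (a : ℝ) ≠ b := fun h => huv.ne (by rw [Subtype.ext h])
  let l : ℝ → ℝ := AffineMap.lineMap (a : ℝ) (b : ℝ)
  have hl : Continuous l := AffineMap.lineMap_continuous
  have hlmem {r : ℝ} (hr : r ∈ Set.Icc (0 : ℝ) 1) : l r ∈ Set.Icc (0 : ℝ) 1 :=
    (convex_Icc (0 : ℝ) 1).lineMap_mem a.2 b.2 hr
  let γ : ℝ → ℝ × ℝ := fun r => f (Set.projIcc 0 1 zero_le_one (l r))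
  have hγ : Continuous γ := hf.comp (continuous_projIcc.comp hl)
  have hinj : Set.InjOn γ (Set.Icc 0 1) := fun x hx y hy h => by
    have h' := hfinj h
    rw [Set.projIcc_of_mem _ (hlmem hx), Set.projIcc_of_mem _ (hlmem hy)] at h'
    exact AffineMap.lineMap_injective ℝ hab (congrArg Subtype.val h')
  have hγ0 : γ 0 = f a := by simp [γ, l]
  have hγ1 : γ 1 = f b := by simp [γ, l]
  obtain ⟨p, hap, hpb⟩ := exists_rat_btwn huv
  obtain ⟨q, hpq, hqb⟩ := exists_rat_btwn hpb
  obtain ⟨s, t, hs, hst, ht, hsp, htq, huniq⟩ :=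
    exists_minimal_crossing (hg.comp hγ) hpq (by simpa [hγ0] using hap) (by simpa [hγ1] using hqb)
  refine ⟨p, q, by exact_mod_cast hpq, γ '' Set.Icc s t, ?_, γ s, γ t,
    isArcWith_image_Icc hγ hst (hinj.mono (Set.Icc_subset_Icc hs ht)), ?_, ?_⟩
  · rintro - ⟨r, -, rfl⟩
    exact ⟨_, rfl⟩
  · refine Set.Subset.antisymm ?_ ?_
    · rintro - ⟨⟨r, hr, rfl⟩, h⟩
      exact congrArg γ ((huniq r hr).1 h)
    · rintro - rfl
      exact ⟨⟨s, Set.left_mem_Icc.2 hst.le, rfl⟩, hsp⟩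
  · refine Set.Subset.antisymm ?_ ?_
    · rintro - ⟨⟨r, hr, rfl⟩, h⟩
      exact congrArg γ ((huniq r hr).2 h)
    · rintro - rfl
      exact ⟨⟨t, Set.right_mem_Icc.2 hst.le, rfl⟩, htq⟩

/-- If an arc `A ⊆ ℝ²` contains two distinct points `u` and `v`, then there are
rationals `p < q` and a sub-arc `J ⊆ A` which meets either the two vertical lines
`x = p`, `x = q`, or the two horizontal lines `y = p`, `y = q`, exactly in its two
endpoints. -/
theorem statement13 (A : Set (ℝ × ℝ)) (hA : IsArc A)
    (u v : ℝ × ℝ) (hu : u ∈ A) (hv : v ∈ A) (huv : u ≠ v) :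
    ∃ p q : ℚ, p < q ∧ ∃ J : Set (ℝ × ℝ), J ⊆ A ∧
      ∃ w₁ w₂ : ℝ × ℝ, IsArcWith J w₁ w₂ ∧
        ((J ∩ {z : ℝ × ℝ | z.1 = (p : ℝ)} = {w₁} ∧
          J ∩ {z : ℝ × ℝ | z.1 = (q : ℝ)} = {w₂}) ∨
         (J ∩ {z : ℝ × ℝ | z.2 = (p : ℝ)} = {w₁} ∧
          J ∩ {z : ℝ × ℝ | z.2 = (q : ℝ)} = {w₂})) := by
  have separated {g : ℝ × ℝ → ℝ} (hg : Continuous g) (h : g u ≠ g v) :=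
    h.lt_or_gt.elim (hA.exists_subarc_of_lt hg hu hv) (hA.exists_subarc_of_lt hg hv hu)
  by_cases h : u.1 = v.1
  · obtain ⟨p, q, hpq, J, hJ, w₁, w₂, harc, hw⟩ :=
      separated continuous_snd fun h' => huv (Prod.ext h h')
    exact ⟨p, q, hpq, J, hJ, w₁, w₂, harc, Or.inr hw⟩
  · obtain ⟨p, q, hpq, J, hJ, w₁, w₂, harc, hw⟩ := separated continuous_fst h
    exact ⟨p, q, hpq, J, hJ, w₁, w₂, harc, Or.inl hw⟩
end
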